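/- Let N ≥ 1 and let ν : Fin N → ℝ satisfy ν j ≥ 0 for all j, and assume ν is not constant. Let νmin = min_j ν j and let d be the number of indices j with ν j = νmin. Then for every real s with log d < s < log N there exists a unique γ > 0 satisfying log Z̃(γ) + (γ / Z̃(γ)) * Σ_j ν j * exp(−γ * ν j) = s, where Z̃(γ) = Σ_j exp(−γ * ν j); and for this γ, the infimum of Σ_j ν j * λ j over all λ ∈ Δ_N with H(λ) ≥ s equals (1 / Z̃(γ)) * Σ_j ν j * exp(−γ * ν j), is attained at the vector λ j = exp(−γ * ν j) / Z̃(γ), and is strictly greater than νmin. -/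

import Mathlib

open scoped Classical

/-- The tangent-line bound for `x * log (y / x)`, strict off the diagonal. -/
theorem negMulLog_add_mul_log_lt {x y : ℝ} (hx : 0 ≤ x) (hy : 0 < y) (hxy : x ≠ y) :
    Real.negMulLog x + x * Real.log y < y - x := by
  rcases hx.eq_or_lt with rfl | hx
  · simpa using hy
  · have h := Real.log_lt_sub_one_of_pos (div_pos hy hx)
      (fun h => hxy ((div_eq_one_iff_eq hx.ne').1 h).symm)
    rw [Real.log_div hy.ne' hx.ne'] at h
    have h2 := mul_lt_mul_of_pos_left h hx
    have h3 : x * (y / x - 1) = y - x := by field_simp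
    rw [h3] at h2
    rw [Real.negMulLog]
    linarith

theorem negMulLog_add_mul_log_le {x y : ℝ} (hx : 0 ≤ x) (hy : 0 < y) :
    Real.negMulLog x + x * Real.log y ≤ y - x := by
  by_cases hxy : x = y
  · subst hxy
    simp [Real.negMulLog]
  · exact (negMulLog_add_mul_log_lt hx hy hxy).le

section Gibbs

variable {ι : Type*} [Fintype ι]

/-- The partition function of the energies `ν` at inverse temperature `γ`. -/
noncomputable def gibbsZ (ν : ι → ℝ) (γ : ℝ) : ℝ := ∑ j, Real.exp (-γ * ν j)

/-- The unnormalized mean energy of `ν` at inverse temperature `γ`. -/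
noncomputable def gibbsM (ν : ι → ℝ) (γ : ℝ) : ℝ := ∑ j, ν j * Real.exp (-γ * ν j)

/-- The Gibbs vector of `ν` at inverse temperature `γ`. -/
noncomputable def gibbsVec (ν : ι → ℝ) (γ : ℝ) (j : ι) : ℝ := Real.exp (-γ * ν j) / gibbsZ ν γ

/-- The entropy of the Gibbs vector, in closed form. -/
noncomputable def gibbsEntropy (ν : ι → ℝ) (γ : ℝ) : ℝ :=
  Real.log (gibbsZ ν γ) + γ / gibbsZ ν γ * gibbsM ν γ

theorem gibbsZ_pos [Nonempty ι] (ν : ι → ℝ) (γ : ℝ) : 0 < gibbsZ ν γ :=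
  Finset.sum_pos (fun _ _ => Real.exp_pos _) Finset.univ_nonempty

theorem gibbsVec_pos [Nonempty ι] (ν : ι → ℝ) (γ : ℝ) (j : ι) : 0 < gibbsVec ν γ j :=
  div_pos (Real.exp_pos _) (gibbsZ_pos ν γ)

theorem sum_gibbsVec [Nonempty ι] (ν : ι → ℝ) (γ : ℝ) : ∑ j, gibbsVec ν γ j = 1 := by
  simp only [gibbsVec]
  rw [← Finset.sum_div]
  exact div_self (gibbsZ_pos ν γ).ne'

theorem log_gibbsVec [Nonempty ι] (ν : ι → ℝ) (γ : ℝ) (j : ι) :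
    Real.log (gibbsVec ν γ j) = -γ * ν j - Real.log (gibbsZ ν γ) := by
  rw [gibbsVec, Real.log_div (Real.exp_pos _).ne' (gibbsZ_pos ν γ).ne', Real.log_exp]

theorem sum_mul_gibbsVec (ν : ι → ℝ) (γ : ℝ) :
    ∑ j, ν j * gibbsVec ν γ j = 1 / gibbsZ ν γ * gibbsM ν γ := by
  rw [gibbsM, Finset.mul_sum]
  exact Finset.sum_congr rfl fun j _ => by rw [gibbsVec]; ring

theorem sum_mul_log_gibbsVec [Nonempty ι] (ν : ι → ℝ) (γ : ℝ) {p : ι → ℝ}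
    (hp : ∑ j, p j = 1) :
    ∑ j, p j * Real.log (gibbsVec ν γ j) =
      -(Real.log (gibbsZ ν γ) + γ * ∑ j, ν j * p j) := by
  have h : ∀ j, p j * Real.log (gibbsVec ν γ j) =
      -(p j * Real.log (gibbsZ ν γ) + γ * (ν j * p j)) := fun j => by
    rw [log_gibbsVec]; ring
  simp only [h]
  rw [Finset.sum_neg_distrib, Finset.sum_add_distrib, ← Finset.sum_mul, ← Finset.mul_sum, hp,
    one_mul]

theorem sum_negMulLog_gibbsVec [Nonempty ι] (ν : ι → ℝ) (γ : ℝ) :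
    ∑ j, Real.negMulLog (gibbsVec ν γ j) = gibbsEntropy ν γ := by
  have h := sum_mul_log_gibbsVec ν γ (sum_gibbsVec ν γ)
  simp only [Real.negMulLog, neg_mul, Finset.sum_neg_distrib]
  rw [h, sum_mul_gibbsVec, gibbsEntropy]
  ring

/-- The Gibbs variational inequality. -/
theorem sum_negMulLog_le_gibbs [Nonempty ι] (ν : ι → ℝ) (γ : ℝ) {p : ι → ℝ}
    (hp0 : ∀ j, 0 ≤ p j) (hp : ∑ j, p j = 1) :
    ∑ j, Real.negMulLog (p j) ≤ Real.log (gibbsZ ν γ) + γ * ∑ j, ν j * p j := by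
  have h := Finset.sum_le_sum fun j (_ : j ∈ Finset.univ) =>
    negMulLog_add_mul_log_le (hp0 j) (gibbsVec_pos ν γ j)
  rw [Finset.sum_add_distrib, Finset.sum_sub_distrib, sum_mul_log_gibbsVec ν γ hp, hp,
    sum_gibbsVec] at h
  linarith

theorem sum_negMulLog_lt_gibbs [Nonempty ι] (ν : ι → ℝ) (γ : ℝ) {p : ι → ℝ}
    (hp0 : ∀ j, 0 ≤ p j) (hp : ∑ j, p j = 1) (hne : p ≠ gibbsVec ν γ) :
    ∑ j, Real.negMulLog (p j) < Real.log (gibbsZ ν γ) + γ * ∑ j, ν j * p j := by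
  obtain ⟨i, hi⟩ := Function.ne_iff.1 hne
  have h := Finset.sum_lt_sum (fun j (_ : j ∈ Finset.univ) =>
    negMulLog_add_mul_log_le (hp0 j) (gibbsVec_pos ν γ j))
    ⟨i, Finset.mem_univ i, negMulLog_add_mul_log_lt (hp0 i) (gibbsVec_pos ν γ i) hi⟩
  rw [Finset.sum_add_distrib, Finset.sum_sub_distrib, sum_mul_log_gibbsVec ν γ hp, hp,
    sum_gibbsVec] at h
  linarith

theorem gibbsVec_injective [Nonempty ι] {ν : ι → ℝ} (hν : ∃ i j, ν i ≠ ν j) :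
    Function.Injective (gibbsVec ν) := by
  obtain ⟨i, j, hij⟩ := hν
  intro γ₁ γ₂ h
  have hi := congrArg Real.log (congrFun h i)
  have hj := congrArg Real.log (congrFun h j)
  simp only [log_gibbsVec] at hi hj
  have h0 : (γ₁ - γ₂) * (ν i - ν j) = 0 := by linarith
  rcases mul_eq_zero.1 h0 with h1 | h1
  · exact sub_eq_zero.1 h1
  · exact absurd (sub_eq_zero.1 h1) hij

theorem gibbsEntropy_injOn [Nonempty ι] {ν : ι → ℝ} (hν : ∃ i j, ν i ≠ ν j) :
    Set.InjOn (gibbsEntropy ν) (Set.Ioi 0) := by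
  intro γ₁ h₁ γ₂ h₂ h
  rw [Set.mem_Ioi] at h₁ h₂
  by_contra hne
  have key : ∀ a b : ℝ, 0 < b → a ≠ b → gibbsEntropy ν a = gibbsEntropy ν b →
      1 / gibbsZ ν b * gibbsM ν b < 1 / gibbsZ ν a * gibbsM ν a := by
    intro a b hb hab he
    have hlt := sum_negMulLog_lt_gibbs ν b (fun j => (gibbsVec_pos ν a j).le)
      (sum_gibbsVec ν a) ((gibbsVec_injective hν).ne hab)
    rw [sum_negMulLog_gibbsVec, sum_mul_gibbsVec, he, gibbsEntropy] at hlt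
    have h3 : b / gibbsZ ν b * gibbsM ν b = b * (1 / gibbsZ ν b * gibbsM ν b) := by ring
    rw [h3] at hlt
    exact lt_of_mul_lt_mul_left (by linarith) hb.le
  exact lt_asymm (key γ₁ γ₂ h₂ hne h) (key γ₂ γ₁ h₁ (Ne.symm hne) h.symm)

theorem continuous_gibbsEntropy [Nonempty ι] (ν : ι → ℝ) : Continuous (gibbsEntropy ν) := by
  have hZ : Continuous (gibbsZ ν) := by unfold gibbsZ; fun_prop
  have hM : Continuous (gibbsM ν) := by unfold gibbsM; fun_prop
  have h0 : ∀ γ, gibbsZ ν γ ≠ 0 := fun γ => (gibbsZ_pos ν γ).ne'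
  unfold gibbsEntropy
  exact (hZ.log h0).add ((continuous_id.div hZ h0).mul hM)

/-- The Gibbs entropy does not change when the energies are shifted by a constant. -/
theorem gibbsEntropy_sub_const [Nonempty ι] (ν : ι → ℝ) (c γ : ℝ) :
    gibbsEntropy (fun j => ν j - c) γ = gibbsEntropy ν γ := by
  have h : gibbsVec (fun j => ν j - c) γ = gibbsVec ν γ := by
    have he : ∀ j, Real.exp (-γ * (ν j - c)) = Real.exp (γ * c) * Real.exp (-γ * ν j) :=
      fun j => by rw [← Real.exp_add]; ring_nf
    funext j
    simp only [gibbsVec, gibbsZ, he]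
    rw [← Finset.mul_sum, mul_div_mul_left _ _ (Real.exp_pos _).ne']
  rw [← sum_negMulLog_gibbsVec, ← sum_negMulLog_gibbsVec, h]

open Filter Topology in
/-- At zero temperature the Gibbs entropy tends to the logarithm of the ground state
degeneracy. -/
theorem tendsto_gibbsEntropy_atTop [Nonempty ι] {ν : ι → ℝ} {m : ℝ}
    (hm : IsLeast (Set.range ν) m) :
    Tendsto (gibbsEntropy ν) atTop
      (𝓝 (Real.log ((Finset.univ.filter (fun j => ν j = m)).card : ℝ))) := by
  have hexp : ∀ j, Tendsto (fun γ : ℝ => Real.exp (-γ * (ν j - m))) atTop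
      (𝓝 (if ν j = m then 1 else 0)) := by
    intro j
    split_ifs with h
    · simp [h]
    · have hpos : 0 < ν j - m :=
        sub_pos.2 (lt_of_le_of_ne (hm.2 ⟨j, rfl⟩) (Ne.symm h))
      refine Real.tendsto_exp_atBot.comp ?_
      exact tendsto_neg_atTop_atBot.atBot_mul_const hpos
  have hZ : Tendsto (gibbsZ fun j => ν j - m) atTop
      (𝓝 ((Finset.univ.filter (fun j => ν j = m)).card : ℝ)) := by
    have h := tendsto_finsetSum Finset.univ fun j _ => hexp j
    rwa [Finset.sum_boole] at h
  have hM : Tendsto (fun γ : ℝ => γ * gibbsM (fun j => ν j - m) γ) atTop (𝓝 0) := by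
    have hterm : ∀ j, Tendsto (fun γ : ℝ => γ * ((ν j - m) * Real.exp (-γ * (ν j - m)))) atTop
        (𝓝 0) := by
      intro j
      rcases (sub_nonneg.2 (hm.2 ⟨j, rfl⟩)).eq_or_lt with h | h
      · simp [← h]
      · have h1 := (Real.tendsto_pow_mul_exp_neg_atTop_nhds_zero 1).comp
          (tendsto_id.atTop_mul_const h)
        refine h1.congr fun γ => ?_
        simp only [Function.comp_apply, id, pow_one, neg_mul]
        ring
    have h := tendsto_finsetSum Finset.univ fun j _ => hterm j
    simpa [gibbsM, Finset.mul_sum] using h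
  have hd : ((Finset.univ.filter (fun j => ν j = m)).card : ℝ) ≠ 0 := by
    obtain ⟨j, hj⟩ := hm.1
    exact Nat.cast_ne_zero.2 (Finset.card_ne_zero.2 ⟨j, by simpa using hj⟩)
  have h := (hZ.log hd).add (hM.div hZ hd)
  rw [zero_div, add_zero] at h
  refine h.congr fun γ => ?_
  rw [← gibbsEntropy_sub_const ν m, gibbsEntropy, Pi.div_apply]
  ring

theorem lt_gibbs_mean [Nonempty ι] {ν : ι → ℝ} (hν : ∃ i j, ν i ≠ ν j) {m : ℝ}
    (hm : ∀ j, m ≤ ν j) (γ : ℝ) : m < 1 / gibbsZ ν γ * gibbsM ν γ := by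
  obtain ⟨k, hk⟩ : ∃ k, m < ν k := by
    by_contra! h
    obtain ⟨i, j, hij⟩ := hν
    exact hij (((h i).antisymm (hm i)).trans ((h j).antisymm (hm j)).symm)
  have h : ∑ j, m * gibbsVec ν γ j < ∑ j, ν j * gibbsVec ν γ j :=
    Finset.sum_lt_sum
      (fun j _ => mul_le_mul_of_nonneg_right (hm j) (gibbsVec_pos ν γ j).le)
      ⟨k, Finset.mem_univ k, mul_lt_mul_of_pos_right hk (gibbsVec_pos ν γ k)⟩
  rwa [← Finset.mul_sum, sum_gibbsVec, mul_one, sum_mul_gibbsVec] at h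

theorem exists_gibbsEntropy_eq [Nonempty ι] {ν : ι → ℝ} {m : ℝ}
    (hm : IsLeast (Set.range ν) m) {s : ℝ}
    (hs1 : Real.log ((Finset.univ.filter (fun j => ν j = m)).card : ℝ) < s)
    (hs2 : s < Real.log (Fintype.card ι)) :
    ∃ γ, 0 < γ ∧ gibbsEntropy ν γ = s := by
  obtain ⟨T, hT, hT0⟩ := (((tendsto_gibbsEntropy_atTop hm).eventually_lt_const hs1).and
    (Filter.eventually_gt_atTop 0)).exists
  have h0 : gibbsEntropy ν 0 = Real.log (Fintype.card ι) := by simp [gibbsEntropy, gibbsZ]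
  obtain ⟨γ, hγ, he⟩ := intermediate_value_Ioo' hT0.le (continuous_gibbsEntropy ν).continuousOn
    ⟨hT, by rwa [h0]⟩
  exact ⟨γ, hγ.1, he⟩

end Gibbs

/-- high-entanglement regime of the relaxed minimal privacy energy
(Theorem 5(ii)): for `log d < s < log N` there is a unique Gibbs parameter
`γ > 0` solving the entropy equation, and for this `γ` the entropy-constrained
linear minimization over the simplex is attained at the inverse Gibbs vector
and is strictly greater than `νmin`. -/
theorem stmt6 (N : ℕ) (hN : 1 ≤ N) (ν : Fin N → ℝ) (hν : ∀ j, 0 ≤ ν j)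
    (hnc : ∃ i j, ν i ≠ ν j)
    (νmin : ℝ) (hmin : IsLeast (Set.range ν) νmin)
    (d : ℕ) (hd : d = (Finset.univ.filter (fun j => ν j = νmin)).card)
    (s : ℝ) (hs1 : Real.log d < s) (hs2 : s < Real.log N) :
    (∃! γ : ℝ, 0 < γ ∧
      Real.log (∑ j, Real.exp (-γ * ν j)) +
        (γ / (∑ j, Real.exp (-γ * ν j))) * (∑ j, ν j * Real.exp (-γ * ν j)) = s) ∧
    (∀ γ : ℝ, 0 < γ →
      Real.log (∑ j, Real.exp (-γ * ν j)) +
        (γ / (∑ j, Real.exp (-γ * ν j))) * (∑ j, ν j * Real.exp (-γ * ν j)) = s →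
      ((∀ lam : Fin N → ℝ, (∀ j, 0 ≤ lam j) → (∑ j, lam j) = 1 →
          s ≤ (∑ j, Real.negMulLog (lam j)) →
          (1 / (∑ j, Real.exp (-γ * ν j))) * (∑ j, ν j * Real.exp (-γ * ν j)) ≤
            ∑ j, ν j * lam j) ∧
        (∀ j, 0 ≤ Real.exp (-γ * ν j) / (∑ k, Real.exp (-γ * ν k))) ∧
        (∑ j, Real.exp (-γ * ν j) / (∑ k, Real.exp (-γ * ν k))) = 1 ∧
        s ≤ (∑ j, Real.negMulLog (Real.exp (-γ * ν j) / (∑ k, Real.exp (-γ * ν k)))) ∧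
        (∑ j, ν j * (Real.exp (-γ * ν j) / (∑ k, Real.exp (-γ * ν k)))) =
          (1 / (∑ j, Real.exp (-γ * ν j))) * (∑ j, ν j * Real.exp (-γ * ν j)) ∧
        νmin < (1 / (∑ j, Real.exp (-γ * ν j))) * (∑ j, ν j * Real.exp (-γ * ν j)))) := by
  have : Nonempty (Fin N) := ⟨⟨0, hN⟩⟩
  subst hd
  refine ⟨?_, fun γ hγ he => ⟨fun p hp0 hp hs => ?_, fun j => (gibbsVec_pos ν γ j).le,
    sum_gibbsVec ν γ, ?_, sum_mul_gibbsVec ν γ, lt_gibbs_mean hnc (fun j => hmin.2 ⟨j, rfl⟩) γ⟩⟩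
  · obtain ⟨γ, hγ, he⟩ := exists_gibbsEntropy_eq hmin hs1 (by simpa using hs2)
    exact ⟨γ, ⟨hγ, he⟩, fun γ' h => gibbsEntropy_injOn hnc h.1 hγ (h.2.trans he.symm)⟩
  · have h := hs.trans (sum_negMulLog_le_gibbs ν γ hp0 hp)
    change gibbsEntropy ν γ = s at he
    rw [← he, gibbsEntropy, div_eq_mul_one_div, mul_assoc] at h
    exact le_of_mul_le_mul_left (le_of_add_le_add_left h) hγ
  · exact (he.symm.trans (sum_negMulLog_gibbsVec ν γ).symm).le
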